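/- Let u₂ > 0, set Y = f + u₂·g, and let x = (x₁, x₂) ∈ ℝ² with x₁ > 0. For every t ∈ ℝ, the family n ↦ (tⁿ/n!)·adⁿY(g)(x) is summable in ℝ² with sum g(x) + (sin(2√u₂·t)/(2√u₂))·[f, g](x) + ((1 − cos(2√u₂·t))/(2u₂))·(f(x) − u₂·g(x)). (Closed form of e^{t·adY}(g), used in Lemma 3.6.) -/

import Mathlib

/-- The drift vector field `f(x₁,x₂) = (x₂, x₁⁻³)`, extended by `0⁻¹ = 0`. -/
noncomputable def fVF : ℝ × ℝ → ℝ × ℝ := fun x => (x.2, ((x.1)^3)⁻¹)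

/-- The control vector field `g(x₁,x₂) = (0, −x₁)`. -/
def gVF : ℝ × ℝ → ℝ × ℝ := fun x => (0, -x.1)

/-- Lie bracket of vector fields on ℝ²: `[V,W](x) = DW(x)·V(x) − DV(x)·W(x)`. -/
noncomputable def lieBr (V W : ℝ × ℝ → ℝ × ℝ) : ℝ × ℝ → ℝ × ℝ :=
  fun x => fderiv ℝ W x (V x) - fderiv ℝ V x (W x)

/-- Adjoint iterates: `ad⁰V(W) = W`, `ad^{k+1}V(W) = [V, ad^k V(W)]`. -/
noncomputable def adIter (V : ℝ × ℝ → ℝ × ℝ) : ℕ → (ℝ × ℝ → ℝ × ℝ) → (ℝ × ℝ → ℝ × ℝ)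
  | 0, W => W
  | (k+1), W => lieBr V (adIter V k W)

open Filter Topology

lemma lieBr_congr_right {V W W' : ℝ × ℝ → ℝ × ℝ} {x : ℝ × ℝ} (h : W =ᶠ[𝓝 x] W') :
    lieBr V W x = lieBr V W' x := by
  simp only [lieBr, h.fderiv_eq, h.eq_of_nhds]

lemma lieBr_const_smul_right (V W : ℝ × ℝ → ℝ × ℝ) (c : ℝ) (x : ℝ × ℝ) :
    lieBr V (fun y => c • W y) x = c • lieBr V W x := by
  have h : fderiv ℝ (fun y => c • W y) x = c • fderiv ℝ W x :=
    congrFun (fderiv_const_smul_field c) x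
  simp only [lieBr, h, smul_apply, map_smul, smul_sub]

lemma fderiv_snd_inv_cube_add_mul (a : ℝ) {x : ℝ × ℝ} (hx : 0 < x.1) (v : ℝ × ℝ) :
    fderiv ℝ (fun y : ℝ × ℝ => (y.2, (y.1 ^ 3)⁻¹ + a * y.1)) x v
      = (v.2, (-3 * (x.1 ^ 4)⁻¹ + a) * v.1) := by
  have hne : x.1 ≠ 0 := hx.ne'
  have hscalar : HasDerivAt (fun s : ℝ => (s ^ 3)⁻¹ + a * s) (-3 * (x.1 ^ 4)⁻¹ + a) x.1 := by
    have h := ((hasDerivAt_pow 3 x.1).inv (pow_ne_zero 3 hne)).add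
      ((hasDerivAt_id x.1).const_mul a)
    refine h.congr_deriv ?_
    push_cast
    field_simp
  have h := (hasFDerivAt_snd (𝕜 := ℝ) (p := x)).prodMk
    (hscalar.comp_hasFDerivAt x (hasFDerivAt_fst (𝕜 := ℝ) (p := x)))
  have h' := h.fderiv
  simp only [Function.comp_def] at h'
  rw [h']
  simp

lemma fderiv_gVF (x v : ℝ × ℝ) : fderiv ℝ gVF x v = (0, -v.1) := by
  have h := (hasFDerivAt_const (𝕜 := ℝ) (0 : ℝ) x).prodMk (hasFDerivAt_fst (𝕜 := ℝ) (p := x)).neg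
  have h' : fderiv ℝ gVF x = _ := h.fderiv
  rw [h']
  simp

lemma fderiv_fst_neg_snd (x v : ℝ × ℝ) :
    fderiv ℝ (fun y : ℝ × ℝ => (y.1, -y.2)) x v = (v.1, -v.2) := by
  have h := (hasFDerivAt_fst (𝕜 := ℝ) (p := x)).prodMk (hasFDerivAt_snd (𝕜 := ℝ) (p := x)).neg
  have h' : fderiv ℝ (fun y : ℝ × ℝ => (y.1, -y.2)) x = _ := h.fderiv
  rw [h']
  simp

lemma fVF_add_smul_gVF (u : ℝ) :
    (fun y => fVF y + u • gVF y) = fun y : ℝ × ℝ => (y.2, (y.1 ^ 3)⁻¹ + -u * y.1) := by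
  funext y
  simp [fVF, gVF]

lemma fVF_sub_smul_gVF (u : ℝ) :
    (fun y => fVF y - u • gVF y) = fun y : ℝ × ℝ => (y.2, (y.1 ^ 3)⁻¹ + u * y.1) := by
  funext y
  simp [fVF, gVF]

lemma lieBr_add_smul_gVF (u : ℝ) {x : ℝ × ℝ} (hx : 0 < x.1) :
    lieBr (fun y => fVF y + u • gVF y) gVF x = (x.1, -x.2) := by
  rw [fVF_add_smul_gVF, lieBr, fderiv_gVF, fderiv_snd_inv_cube_add_mul _ hx]
  simp [gVF]

lemma lieBr_fVF_gVF {x : ℝ × ℝ} (hx : 0 < x.1) : lieBr fVF gVF x = (x.1, -x.2) := by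
  simpa using lieBr_add_smul_gVF 0 hx

lemma lieBr_add_smul_fst_neg_snd (u : ℝ) {x : ℝ × ℝ} (hx : 0 < x.1) :
    lieBr (fun y => fVF y + u • gVF y) (fun y => (y.1, -y.2)) x
      = (2 : ℝ) • (fVF x - u • gVF x) := by
  have hne : x.1 ≠ 0 := hx.ne'
  rw [fVF_add_smul_gVF, lieBr, fderiv_fst_neg_snd, fderiv_snd_inv_cube_add_mul _ hx]
  ext
  · simp [fVF, gVF]; ring
  · simp [fVF, gVF]; field_simp; ring

lemma lieBr_add_smul_sub_smul (u : ℝ) {x : ℝ × ℝ} (hx : 0 < x.1) :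
    lieBr (fun y => fVF y + u • gVF y) (fun y => fVF y - u • gVF y) x
      = (-2 * u) • (x.1, -x.2) := by
  rw [fVF_add_smul_gVF, fVF_sub_smul_gVF, lieBr, fderiv_snd_inv_cube_add_mul _ hx,
    fderiv_snd_inv_cube_add_mul _ hx]
  ext
  · simp; ring
  · simp; ring

lemma eventually_fst_pos {x : ℝ × ℝ} (hx : 0 < x.1) : ∀ᶠ y : ℝ × ℝ in 𝓝 x, 0 < y.1 :=
  continuous_fst.continuousAt.eventually (lt_mem_nhds hx)

lemma adIter_odd_even (u : ℝ) (m : ℕ) : ∀ x : ℝ × ℝ, 0 < x.1 →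
    adIter (fun y => fVF y + u • gVF y) (2 * m + 1) gVF x = ((-4 * u) ^ m) • (x.1, -x.2) ∧
    adIter (fun y => fVF y + u • gVF y) (2 * m + 2) gVF x
      = (2 * (-4 * u) ^ m) • (fVF x - u • gVF x) := by
  have even_of_odd : ∀ k : ℕ, (∀ x : ℝ × ℝ, 0 < x.1 →
      adIter (fun y => fVF y + u • gVF y) (2 * k + 1) gVF x = ((-4 * u) ^ k) • (x.1, -x.2)) →
      ∀ x : ℝ × ℝ, 0 < x.1 → adIter (fun y => fVF y + u • gVF y) (2 * k + 2) gVF x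
        = (2 * (-4 * u) ^ k) • (fVF x - u • gVF x) := by
    intro k hk x hx
    rw [adIter, lieBr_congr_right ((eventually_fst_pos hx).mono hk), lieBr_const_smul_right,
      lieBr_add_smul_fst_neg_snd u hx, smul_smul, mul_comm]
  induction m with
  | zero =>
    have odd : ∀ x : ℝ × ℝ, 0 < x.1 →
        adIter (fun y => fVF y + u • gVF y) (2 * 0 + 1) gVF x
          = ((-4 * u) ^ 0) • (x.1, -x.2) := by
      intro x hx
      rw [pow_zero, one_smul]
      exact lieBr_add_smul_gVF u hx
    exact fun x hx => ⟨odd x hx, even_of_odd 0 odd x hx⟩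
  | succ k ih =>
    have odd : ∀ x : ℝ × ℝ, 0 < x.1 →
        adIter (fun y => fVF y + u • gVF y) (2 * (k + 1) + 1) gVF x
          = ((-4 * u) ^ (k + 1)) • (x.1, -x.2) := by
      intro x hx
      rw [show 2 * (k + 1) + 1 = (2 * k + 2) + 1 by ring, adIter,
        lieBr_congr_right ((eventually_fst_pos hx).mono fun y hy => (ih y hy).2),
        lieBr_const_smul_right, lieBr_add_smul_sub_smul u hx, smul_smul]
      congr 1
      ring
    exact fun x hx => ⟨odd x hx, even_of_odd (k + 1) odd x hx⟩

/-- Closed form of `e^{t·adY}(g)` for `Y = f + u₂ g`, `u₂ > 0` (used in Lemma 3.6):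
the series `∑ (tⁿ/n!) adⁿY(g)(x)` sums to
`g(x) + (sin(2√u₂ t)/(2√u₂)) [f,g](x) + ((1 − cos(2√u₂ t))/(2u₂)) (f(x) − u₂ g(x))`. -/
theorem stmt_7 (u₂ : ℝ) (hu₂ : 0 < u₂) (x : ℝ × ℝ) (hx : 0 < x.1) (t : ℝ) :
    HasSum
      (fun n : ℕ => (t^n / (n.factorial : ℝ)) •
        adIter (fun y => fVF y + u₂ • gVF y) n gVF x)
      (gVF x + (Real.sin (2 * Real.sqrt u₂ * t) / (2 * Real.sqrt u₂)) • lieBr fVF gVF x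
        + ((1 - Real.cos (2 * Real.sqrt u₂ * t)) / (2 * u₂)) • (fVF x - u₂ • gVF x)) := by
  have hsqrt : Real.sqrt u₂ ^ 2 = u₂ := Real.sq_sqrt hu₂.le
  have hsqrt_ne : Real.sqrt u₂ ≠ 0 := (Real.sqrt_pos.mpr hu₂).ne'
  have hpow : ∀ m : ℕ, (2 * Real.sqrt u₂ * t) ^ (2 * m) = (4 * u₂) ^ m * t ^ (2 * m) := by
    intro m
    rw [mul_pow, pow_mul (2 * Real.sqrt u₂), mul_pow, hsqrt]
    norm_num
  have hneg : ∀ m : ℕ, (-4 * u₂) ^ m = (-1) ^ m * (4 * u₂) ^ m := by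
    intro m
    rw [← mul_pow]
    ring
  have hodd := ((Real.hasSum_sin (2 * Real.sqrt u₂ * t)).div_const
    (2 * Real.sqrt u₂)).smul_const (lieBr fVF gVF x)
  have heven := ((Real.hasSum_cos (2 * Real.sqrt u₂ * t)).mul_right
    (-(1 / (2 * u₂)))).smul_const (fVF x - u₂ • gVF x)
  have hzero := hasSum_ite_eq (0 : ℕ) (gVF x + (1 / (2 * u₂)) • (fVF x - u₂ • gVF x))
  convert HasSum.even_add_odd
    (f := fun n : ℕ => (t ^ n / (n.factorial : ℝ)) •
      adIter (fun y => fVF y + u₂ • gVF y) n gVF x)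
    ((heven.add hzero).congr_fun fun m => ?_) (hodd.congr_fun fun m => ?_) using 1
  · module
  · rcases m with _ | m
    · simp only [adIter, mul_zero, pow_zero, Nat.factorial_zero, Nat.cast_one, if_true]
      module
    · rw [show 2 * (m + 1) = 2 * m + 2 by ring, (adIter_odd_even u₂ m x hx).2,
        if_neg (Nat.succ_ne_zero m), add_zero, smul_smul, show 2 * m + 2 = 2 * (m + 1) by ring,
        hpow, hneg]
      congr 1
      field_simp
      ring
  · rw [(adIter_odd_even u₂ m x hx).1, lieBr_fVF_gVF hx, smul_smul, pow_succ t (2 * m),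
      pow_succ (2 * Real.sqrt u₂ * t) (2 * m), hpow, hneg]
    congr 1
    field_simp
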